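/- Let G be a connected graph with v(G) = k ≥ 2 vertices. Then for every j ≥ 2, the j-th cumulant of the subgraph count N_G in the binomial random-connection model satisfies |κ_j(N_G)| ≤ (j^{j−1}/a(G)^j) Σ_{r=k}^{1+(k−1)j} |C(j,k,r)| n^r p_n^{d(j,k,r)}, where C(j,k,r) is the set of connected non-flat partitions of [j]×[k] with exactly r blocks and d(j,k,r) := min{e(ρ_G) : ρ ∈ CNF(j,k), |ρ| = r}. -/

import Mathlib

open MeasureTheory Finset ProbabilityTheory

/-- The joint cumulant, via the moment–cumulant formula. -/
noncomputable def jointCumulant {Ω : Type*} [MeasurableSpace Ω] (P : Measure Ω)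
    {j : ℕ} (Z : Fin j → Ω → ℝ) : ℝ :=
  ∑ σ : Finpartition (Finset.univ : Finset (Fin j)),
    (-1 : ℝ) ^ (σ.parts.card - 1) * ((σ.parts.card - 1).factorial : ℝ) *
      ∏ b ∈ σ.parts, ∫ ω, ∏ i ∈ b, Z i ω ∂P

/-- The `j`-th cumulant `κ_j(W)` of a random variable `W`. -/
noncomputable def cum {Ω : Type*} [MeasurableSpace Ω] (P : Measure Ω)
    (j : ℕ) (W : Ω → ℝ) : ℝ :=
  jointCumulant P (fun _ : Fin j => W)

/-- The size `a(G)` of the automorphism group of `G`. -/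
noncomputable def autCard {k : ℕ} (G : SimpleGraph (Fin k)) : ℕ := Nat.card (G ≃g G)

/-- The injective subgraph count `N_G` in the binomial random-connection model:
vertices `X_1,…,X_n`, and `X_i ∼ X_j` iff `Y_{i,j} ≤ p_n H(X_i,X_j)` where the
`Y_{i,j}` are i.i.d. uniform on `[0,1]`. -/
noncomputable def NG {d k n : ℕ} {Ω : Type*} (G : SimpleGraph (Fin k)) [DecidableRel G.Adj]
    (H : (Fin d → ℝ) → (Fin d → ℝ) → ℝ) (pn : ℝ) (aG : ℕ)
    (X : Fin n → Ω → (Fin d → ℝ)) (Y : Fin n → Fin n → Ω → ℝ) (ω : Ω) : ℝ :=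
  (aG : ℝ)⁻¹ * ∑ β ∈ (Finset.univ : Finset (Fin k → Fin n)).filter Function.Injective,
    ∏ q ∈ (Finset.univ : Finset (Fin k × Fin k)).filter (fun q => q.1 < q.2 ∧ G.Adj q.1 q.2),
      if Y (β q.1) (β q.2) ω ≤ pn * H (X (β q.1) ω) (X (β q.2) ω) then (1 : ℝ) else 0

/-- The projection `f_{(ℓ)}` of the subgraph-count functional:
`f_{(ℓ)}(x) = (p^{e(G)}/a(G)) ∫ ∏_{(ı,ȷ)∈E_G} H(x_ı,x_ȷ) dμ^{⊗(k−1)}` with `x_ℓ = x`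
(the unused `ℓ`-th coordinate is also integrated out, which is harmless since `μ` is a
probability measure). -/
noncomputable def fSub {d k : ℕ} (G : SimpleGraph (Fin k)) [DecidableRel G.Adj]
    (H : (Fin d → ℝ) → (Fin d → ℝ) → ℝ) (μ : Measure (Fin d → ℝ)) (pn : ℝ) (aG : ℕ)
    (ℓ : Fin k) (x : Fin d → ℝ) : ℝ :=
  (pn ^ G.edgeFinset.card / (aG : ℝ)) *
    ∫ z : Fin k → (Fin d → ℝ),
      ∏ q ∈ (Finset.univ : Finset (Fin k × Fin k)).filter
          (fun q => q.1 < q.2 ∧ G.Adj q.1 q.2),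
        H (Function.update z ℓ x q.1) (Function.update z ℓ x q.2)
      ∂(Measure.pi fun _ => μ)

/-- A graph `G` is strongly balanced if `e(H)/(v(H)−1) ≤ e(G)/(v(G)−1)` for every
subgraph `H` of `G` with at least two vertices. -/
def StronglyBalanced {k : ℕ} (G : SimpleGraph (Fin k)) [DecidableRel G.Adj] : Prop :=
  ∀ Hs : G.Subgraph, 2 ≤ Hs.verts.ncard →
    Hs.edgeSet.ncard * (k - 1) ≤ G.edgeFinset.card * (Hs.verts.ncard - 1)

/-- A partition of the grid `[j]×[k]` is *non-flat* if every block contains at most one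
element of each row. -/
def NonFlat {j k : ℕ} (ρ : Finpartition (Finset.univ : Finset (Fin j × Fin k))) : Prop :=
  ∀ b ∈ ρ.parts, ∀ x ∈ b, ∀ y ∈ b, Prod.fst x = Prod.fst y → x = y

/-- A partition of the grid `[j]×[k]` is *connected* if the rows cannot be split into two
nonempty groups such that no block contains elements from both groups. -/
def ConnP {j k : ℕ} (ρ : Finpartition (Finset.univ : Finset (Fin j × Fin k))) : Prop :=
  ∀ A : Finset (Fin j), A.Nonempty → A ≠ Finset.univ →
    ∃ b ∈ ρ.parts, (∃ x ∈ b, Prod.fst x ∈ A) ∧ (∃ y ∈ b, Prod.fst y ∉ A)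

/-- The number of edges `e(ρ_G)` of the contraction graph `ρ_G`: blocks `b₁ ≠ b₂` of `ρ`
are adjacent when some row `i` contains `(i,u) ∈ b₁`, `(i,v) ∈ b₂` with `{u,v}` an edge
of `G` (each unordered pair is counted once, whence the division by `2`). -/
def contrEdges {j k : ℕ} (G : SimpleGraph (Fin k)) [DecidableRel G.Adj]
    (ρ : Finpartition (Finset.univ : Finset (Fin j × Fin k))) : ℕ :=
  ((ρ.parts ×ˢ ρ.parts).filter (fun bt =>
    bt.1 ≠ bt.2 ∧ ∃ i : Fin j, ∃ u v : Fin k,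
      G.Adj u v ∧ (i, u) ∈ bt.1 ∧ (i, v) ∈ bt.2)).card / 2

/-- `|C(j,k,r)|`: the number of connected non-flat partitions of `[j]×[k]` with exactly
`r` blocks. -/
noncomputable def cnfCard (j k r : ℕ) : ℕ :=
  Nat.card {ρ : Finpartition (Finset.univ : Finset (Fin j × Fin k)) //
    NonFlat ρ ∧ ConnP ρ ∧ ρ.parts.card = r}

/-- `d(j,k,r) = min{e(ρ_G) : ρ ∈ CNF(j,k), |ρ| = r}`. -/
noncomputable def dMin {k : ℕ} (G : SimpleGraph (Fin k)) [DecidableRel G.Adj]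
    (j r : ℕ) : ℕ :=
  sInf {m : ℕ | ∃ ρ : Finpartition (Finset.univ : Finset (Fin j × Fin k)),
    NonFlat ρ ∧ ConnP ρ ∧ ρ.parts.card = r ∧ contrEdges G ρ = m}

section KernelPartition

variable {α β : Type*} [Fintype α] [DecidableEq α] [DecidableEq β]

/-- The partition of a finite type into the nonempty fibres of a map. -/
def fibrePartition (g : α → β) : Finpartition (Finset.univ : Finset α) :=
  haveI : DecidableRel (Setoid.ker g).r := fun x y => decEq (g x) (g y)
  Finpartition.ofSetoid (Setoid.ker g)

theorem mem_part_fibrePartition {g : α → β} {x y : α} :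
    y ∈ (fibrePartition g).part x ↔ g x = g y := by
  unfold fibrePartition
  rw [Finpartition.mem_part_ofSetoid_iff_rel]
  rfl

theorem part_fibrePartition (g : α → β) (x : α) :
    (fibrePartition g).part x = Finset.univ.filter (fun y => g y = g x) := by
  ext y
  simp [mem_part_fibrePartition, eq_comm]

theorem finpartition_parts_eq_image_part (σ : Finpartition (Finset.univ : Finset α)) :
    σ.parts = Finset.univ.image σ.part := by
  ext b
  simp only [Finset.mem_image, Finset.mem_univ, true_and]
  constructor
  · intro hb
    obtain ⟨x, hx⟩ := σ.nonempty_of_mem_parts hb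
    exact ⟨x, σ.part_eq_of_mem hb hx⟩
  · rintro ⟨x, rfl⟩
    exact σ.part_mem.2 (Finset.mem_univ x)

theorem fibrePartition_eq_iff {g : α → β} {σ : Finpartition (Finset.univ : Finset α)} :
    fibrePartition g = σ ↔ ∀ x y, g x = g y ↔ σ.part x = σ.part y := by
  constructor
  · rintro rfl x y
    rw [← mem_part_fibrePartition,
      Finpartition.mem_part_iff_part_eq_part _ (Finset.mem_univ y) (Finset.mem_univ x), eq_comm]
  · intro h
    apply Finpartition.ext
    rw [finpartition_parts_eq_image_part, finpartition_parts_eq_image_part]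
    congr 1
    funext x
    ext y
    rw [mem_part_fibrePartition, h,
      Finpartition.mem_part_iff_part_eq_part _ (Finset.mem_univ y) (Finset.mem_univ x), eq_comm]

theorem card_filter_fibrePartition_eq [Fintype β]
    (σ : Finpartition (Finset.univ : Finset α)) :
    (Finset.univ.filter (fun g : α → β => fibrePartition g = σ)).card
      = (Fintype.card β).descFactorial σ.parts.card := by
  have hpart : ∀ x, σ.part x ∈ σ.parts := fun x => σ.part_mem.2 (Finset.mem_univ x)
  have hrep : ∀ b : σ.parts, ∃ x, σ.part x = b.1 := fun b => by
    obtain ⟨x, hx⟩ := σ.nonempty_of_mem_parts b.2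
    exact ⟨x, σ.part_eq_of_mem b.2 hx⟩
  choose rep hrep using hrep
  rw [← Fintype.card_coe σ.parts, ← Fintype.card_embedding_eq, ← Finset.card_univ]
  symm
  refine Finset.card_bij (fun e _ x => e ⟨σ.part x, hpart x⟩) ?_ ?_ ?_
  · intro e _
    simp [fibrePartition_eq_iff]
  · intro e _ e' _ h
    ext b
    have := congrFun h (rep b)
    simpa [hrep] using this
  · intro g hg
    have hg' := fibrePartition_eq_iff.1 (Finset.mem_filter.1 hg).2
    refine ⟨⟨fun b => g (rep b), fun b c hbc => ?_⟩, Finset.mem_univ _, ?_⟩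
    · have := (hg' _ _).1 hbc
      rw [hrep, hrep] at this
      exact Subtype.ext this
    · funext x
      exact (hg' _ _).2 (hrep _)

theorem prod_parts_fibrePartition [Fintype β] {M : Type*} [CommMonoid M] (g : α → β)
    (m : Finset α → M) (hm : m ∅ = 1) :
    ∏ b ∈ (fibrePartition g).parts, m b
      = ∏ c : β, m (Finset.univ.filter (fun y => g y = c)) := by
  have himg : (fibrePartition g).parts
      = (Finset.univ.image g).image (fun c => Finset.univ.filter (fun y => g y = c)) := by
    rw [finpartition_parts_eq_image_part, Finset.image_image]
    congr 1
    funext x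
    exact part_fibrePartition g x
  rw [himg, Finset.prod_image]
  · refine Finset.prod_subset (Finset.subset_univ _) fun c _ hc => ?_
    rw [Finset.filter_eq_empty_iff.2, hm]
    rintro y - rfl
    exact hc (Finset.mem_image_of_mem g (Finset.mem_univ y))
  · intro c hc c' _ h
    obtain ⟨x, -, rfl⟩ := Finset.mem_image.1 hc
    simpa using (Finset.ext_iff.1 h x).1 (by simp)

theorem sum_prod_fibres {R : Type*} [CommRing R] [Fintype β] (m : Finset α → R) (hm : m ∅ = 1) :
    ∑ g : α → β, ∏ c : β, m (Finset.univ.filter (fun y => g y = c))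
      = ∑ σ : Finpartition (Finset.univ : Finset α),
        ((Fintype.card β).descFactorial σ.parts.card : R) * ∏ b ∈ σ.parts, m b := by
  rw [← Finset.sum_fiberwise (s := Finset.univ) (g := fun g : α → β => fibrePartition g)]
  refine Finset.sum_congr rfl fun σ _ => ?_
  rw [← card_filter_fibrePartition_eq (β := β) σ, ← nsmul_eq_mul]
  refine Finset.sum_eq_card_nsmul fun g hg => ?_
  rw [← prod_parts_fibrePartition g m hm, (Finset.mem_filter.1 hg).2]

open Polynomial in
/-- The polynomial interpolating `N ↦ ∑_{g : α → [N]} ∏_c m(g⁻¹(c))`; its linear coefficient is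
the cumulant attached to the moments `m`. -/
noncomputable def cumulantPoly (m : Finset α → ℝ) : ℝ[X] :=
  ∑ σ : Finpartition (Finset.univ : Finset α),
    descPochhammer ℝ σ.parts.card * C (∏ b ∈ σ.parts, m b)

theorem eval_cumulantPoly (m : Finset α → ℝ) (hm : m ∅ = 1) (N : ℕ) :
    (cumulantPoly m).eval (N : ℝ)
      = ∑ g : α → Fin N, ∏ c : Fin N, m (Finset.univ.filter (fun y => g y = c)) := by
  rw [sum_prod_fibres m hm, cumulantPoly, Polynomial.eval_finsetSum]
  simp [descPochhammer_eval_eq_descFactorial, Polynomial.eval_prod]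

theorem card_parts_pos [Nonempty α] (σ : Finpartition (Finset.univ : Finset α)) :
    0 < σ.parts.card := by
  obtain ⟨x⟩ := ‹Nonempty α›
  exact Finset.card_pos.2 ⟨_, σ.part_mem.2 (Finset.mem_univ x)⟩

theorem coeff_zero_cumulantPoly [Nonempty α] (m : Finset α → ℝ) :
    (cumulantPoly m).coeff 0 = 0 := by
  rw [Polynomial.coeff_zero_eq_eval_zero, cumulantPoly, Polynomial.eval_finsetSum]
  refine Finset.sum_eq_zero fun σ _ => ?_
  rw [Polynomial.eval_mul, descPochhammer_ne_zero_eval_zero _ (card_parts_pos σ).ne', zero_mul]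

theorem descPochhammer_eval_neg_one (n : ℕ) :
    (descPochhammer ℝ n).eval (-1) = (-1) ^ n * (n.factorial : ℝ) := by
  induction n with
  | zero => simp
  | succ n ih =>
    rw [descPochhammer_succ_eval, ih, Nat.factorial_succ]
    push_cast
    ring

theorem coeff_one_cumulantPoly [Nonempty α] (m : Finset α → ℝ) :
    (cumulantPoly m).coeff 1 = ∑ σ : Finpartition (Finset.univ : Finset α),
      (-1 : ℝ) ^ (σ.parts.card - 1) * ((σ.parts.card - 1).factorial : ℝ) *
        ∏ b ∈ σ.parts, m b := by
  rw [cumulantPoly, Polynomial.finsetSum_coeff]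
  refine Finset.sum_congr rfl fun σ _ => ?_
  obtain ⟨l, hl⟩ := Nat.exists_eq_add_of_lt (card_parts_pos σ)
  rw [hl, zero_add, Polynomial.coeff_mul_C, descPochhammer_succ_left, Polynomial.coeff_X_mul,
    Polynomial.coeff_zero_eq_eval_zero, Polynomial.eval_comp]
  simp [descPochhammer_eval_neg_one]

/-- Moments that factorise along a splitting of the index set have vanishing cumulant. -/
theorem cumulant_sum_eq_zero_of_split (m : Finset α → ℝ) (hm : m ∅ = 1) (p : α → Prop)
    [DecidablePred p] (h1 : ∃ x, p x) (h2 : ∃ x, ¬ p x)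
    (hsplit : ∀ b, m b = m (b.filter p) * m (b.filter fun x => ¬ p x)) :
    ∑ σ : Finpartition (Finset.univ : Finset α),
      (-1 : ℝ) ^ (σ.parts.card - 1) * ((σ.parts.card - 1).factorial : ℝ) *
        ∏ b ∈ σ.parts, m b = 0 := by
  have : Nonempty α := h1.nonempty
  have : Nonempty {x // p x} := h1.elim fun x hx => ⟨⟨x, hx⟩⟩
  have : Nonempty {x // ¬ p x} := h2.elim fun x hx => ⟨⟨x, hx⟩⟩
  let m₁ : Finset {x // p x} → ℝ := fun b => m (b.map (Function.Embedding.subtype _))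
  let m₂ : Finset {x // ¬ p x} → ℝ := fun b => m (b.map (Function.Embedding.subtype _))
  have hm₁ : m₁ ∅ = 1 := by simp [m₁, hm]
  have hm₂ : m₂ ∅ = 1 := by simp [m₂, hm]
  have key : cumulantPoly m = cumulantPoly m₁ * cumulantPoly m₂ := by
    refine Polynomial.eq_of_infinite_eval_eq _ _
      (Set.Infinite.mono ?_ (Set.infinite_range_of_injective (Nat.cast_injective (R := ℝ))))
    rintro _ ⟨N, rfl⟩
    simp only [Set.mem_ofPred_eq, Polynomial.eval_mul]
    rw [eval_cumulantPoly m hm, eval_cumulantPoly m₁ hm₁, eval_cumulantPoly m₂ hm₂,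
      Finset.sum_mul_sum, ← Finset.sum_product', Finset.univ_product_univ]
    refine Fintype.sum_equiv (Equiv.piEquivPiSubtypeProd p fun _ => Fin N) _ _ fun g => ?_
    rw [← Finset.prod_mul_distrib]
    refine Finset.prod_congr rfl fun c _ => ?_
    rw [hsplit]
    congr 2 <;>
    · ext y
      simp [Equiv.piEquivPiSubtypeProd, and_comm]
  rw [← coeff_one_cumulantPoly, key, Polynomial.mul_coeff_one, coeff_zero_cumulantPoly,
    coeff_zero_cumulantPoly]
  simp

theorem sum_factorial_card_parts_le (j : ℕ) (hj : 0 < j) :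
    ∑ σ : Finpartition (Finset.univ : Finset (Fin j)), (σ.parts.card - 1).factorial
      ≤ j ^ (j - 1) := by
  have : Nonempty (Fin j) := ⟨⟨0, hj⟩⟩
  have htotal : ∑ σ : Finpartition (Finset.univ : Finset (Fin j)),
      j.descFactorial σ.parts.card = j ^ j := by
    have := sum_prod_fibres (R := ℤ) (α := Fin j) (β := Fin j) (fun _ => 1) rfl
    simp at this
    exact_mod_cast this.symm
  refine Nat.le_of_mul_le_mul_left (c := j) ?_ hj
  rw [← pow_succ', Nat.sub_add_cancel hj, ← htotal, Finset.mul_sum]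
  refine Finset.sum_le_sum fun σ _ => ?_
  have hle : σ.parts.card ≤ j := by simpa using σ.card_parts_le_card
  obtain ⟨l, hl⟩ := Nat.exists_eq_add_of_lt (card_parts_pos σ)
  obtain ⟨i, rfl⟩ := Nat.exists_eq_add_of_lt hj
  simp only [zero_add] at *
  rw [hl, Nat.succ_descFactorial_succ, Nat.add_sub_cancel]
  refine Nat.mul_le_mul_left _ ?_
  rw [← Nat.descFactorial_self l]
  exact Nat.descFactorial_le l (by omega)

end KernelPartition

section RandomConnection

/-- Unordered pairs of distinct indices, represented by their increasing enumeration. -/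
abbrev VertexPair (n : ℕ) : Type := {q : Fin n × Fin n // q.1 < q.2}

variable {V : Type*} {n : ℕ}

/-- The indicator that all the pairs in `D` are edges. -/
noncomputable def edgesPresent (H : V → V → ℝ) (p : ℝ) (D : Finset (VertexPair n))
    (z : (Fin n → V) × (VertexPair n → ℝ)) : ℝ :=
  ∏ e ∈ D, if z.2 e ≤ p * H (z.1 e.1.1) (z.1 e.1.2) then 1 else 0

/-- The product of the connection function over the pairs in `D`. -/
noncomputable def connectionProd (H : V → V → ℝ) (D : Finset (VertexPair n))
    (x : Fin n → V) : ℝ :=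
  ∏ e ∈ D, H (x e.1.1) (x e.1.2)

variable {H : V → V → ℝ} {p : ℝ}

theorem edgesPresent_eq_ite (D : Finset (VertexPair n)) (z : (Fin n → V) × (VertexPair n → ℝ)) :
    edgesPresent H p D z
      = if ∀ e ∈ D, z.2 e ≤ p * H (z.1 e.1.1) (z.1 e.1.2) then 1 else 0 := by
  rw [edgesPresent, Finset.prod_boole]
  congr 1

theorem edgesPresent_mem_Icc (D : Finset (VertexPair n))
    (z : (Fin n → V) × (VertexPair n → ℝ)) : edgesPresent H p D z ∈ Set.Icc (0 : ℝ) 1 := by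
  rw [edgesPresent_eq_ite]
  split_ifs <;> simp

theorem prod_edgesPresent {ι : Type*} (s : Finset ι) (D : ι → Finset (VertexPair n))
    (z : (Fin n → V) × (VertexPair n → ℝ)) :
    ∏ i ∈ s, edgesPresent H p (D i) z = edgesPresent H p (s.biUnion D) z := by
  simp only [edgesPresent_eq_ite]
  rw [Finset.prod_boole]
  congr 1
  apply propext
  simp only [Finset.mem_biUnion]
  grind

theorem connectionProd_mem_Icc (hH01 : ∀ x y, H x y ∈ Set.Icc (0 : ℝ) 1)
    (D : Finset (VertexPair n)) (x : Fin n → V) : connectionProd H D x ∈ Set.Icc (0 : ℝ) 1 :=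
  ⟨Finset.prod_nonneg fun _ _ => (hH01 _ _).1,
    Finset.prod_le_one (fun _ _ => (hH01 _ _).1) fun _ _ => (hH01 _ _).2⟩

variable [MeasurableSpace V]

/-- The joint law of the vertex locations and of the uniform marks on the pairs. -/
noncomputable def connectionLaw (μ : Measure V) (n : ℕ) :
    Measure ((Fin n → V) × (VertexPair n → ℝ)) :=
  (Measure.pi fun _ => μ).prod (Measure.pi fun _ => volume.restrict (Set.Icc (0 : ℝ) 1))

instance isProbabilityMeasure_restrict_Icc_zero_one :
    IsProbabilityMeasure (volume.restrict (Set.Icc (0 : ℝ) 1)) :=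
  ⟨by simp⟩

instance isProbabilityMeasure_connectionLaw (μ : Measure V) [IsProbabilityMeasure μ] (n : ℕ) :
    IsProbabilityMeasure (connectionLaw μ n) := by
  unfold connectionLaw
  infer_instance

theorem measurable_connection_coord (hHm : Measurable fun z : V × V => H z.1 z.2) (a b : Fin n) :
    Measurable fun x : Fin n → V => H (x a) (x b) :=
  Measurable.comp (g := fun z : V × V => H z.1 z.2) (f := fun x : Fin n → V => (x a, x b)) hHm
    ((measurable_pi_apply a).prodMk (measurable_pi_apply b))

theorem measurable_connectionProd (hHm : Measurable fun z : V × V => H z.1 z.2)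
    (D : Finset (VertexPair n)) : Measurable (connectionProd H D) := by
  unfold connectionProd
  exact Finset.measurable_fun_prod D fun e _ => measurable_connection_coord hHm _ _

theorem measurable_edgesPresent (hHm : Measurable fun z : V × V => H z.1 z.2)
    (D : Finset (VertexPair n)) : Measurable (edgesPresent H p D) := by
  unfold edgesPresent
  refine Finset.measurable_fun_prod D fun e _ => Measurable.ite ?_ measurable_const measurable_const
  exact measurableSet_le ((measurable_pi_apply e).comp measurable_snd)
    (((measurable_connection_coord hHm _ _).comp measurable_fst).const_mul p)

theorem integrable_edgesPresent (hHm : Measurable fun z : V × V => H z.1 z.2)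
    (ν : Measure ((Fin n → V) × (VertexPair n → ℝ))) [IsFiniteMeasure ν]
    (D : Finset (VertexPair n)) : Integrable (edgesPresent H p D) ν := by
  refine Integrable.of_bound (measurable_edgesPresent hHm D).aestronglyMeasurable 1 ?_
  refine Filter.Eventually.of_forall fun z => ?_
  have := edgesPresent_mem_Icc (H := H) (p := p) D z
  rw [Real.norm_eq_abs, abs_le]
  constructor <;> linarith [this.1, this.2]

theorem setIntegral_Icc_le_indicator {t : ℝ} (ht : t ∈ Set.Icc (0 : ℝ) 1) :
    ∫ y in Set.Icc (0 : ℝ) 1, (if y ≤ t then (1 : ℝ) else 0) = t := by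
  have h : (fun y : ℝ => if y ≤ t then (1 : ℝ) else 0) = (Set.Iic t).indicator 1 := by
    ext y
    simp [Set.indicator_apply]
  rw [h, integral_indicator_one measurableSet_Iic, measureReal_restrict_apply measurableSet_Iic]
  have : Set.Iic t ∩ Set.Icc 0 1 = Set.Icc 0 t := by
    ext y
    simp only [Set.mem_inter_iff, Set.mem_Iic, Set.mem_Icc]
    exact ⟨fun h => ⟨h.2.1, h.1⟩, fun h => ⟨h.2, h.1, h.2.trans ht.2⟩⟩
  rw [this, measureReal_def, Real.volume_Icc, sub_zero, ENNReal.toReal_ofReal ht.1]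

theorem integral_edgesPresent {μ : Measure V} [IsProbabilityMeasure μ]
    (hHm : Measurable fun z : V × V => H z.1 z.2)
    (hH01 : ∀ x y, H x y ∈ Set.Icc (0 : ℝ) 1) (hp : p ∈ Set.Icc (0 : ℝ) 1)
    (D : Finset (VertexPair n)) :
    ∫ z, edgesPresent H p D z ∂connectionLaw μ n
      = p ^ D.card * ∫ x, connectionProd H D x ∂Measure.pi fun _ => μ := by
  have hint := integrable_edgesPresent (p := p) hHm (connectionLaw μ n) D
  unfold connectionLaw at hint ⊢
  rw [integral_prod _ hint, ← integral_const_mul]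
  congr 1
  ext x
  let F : VertexPair n → ℝ → ℝ := fun e t =>
    if e ∈ D then (if t ≤ p * H (x e.1.1) (x e.1.2) then 1 else 0) else 1
  have hcond : ∀ y : VertexPair n → ℝ, edgesPresent H p D (x, y) = ∏ e, F e (y e) := by
    intro y
    simp [F, edgesPresent, Finset.prod_ite_mem]
  rw [integral_congr_ae (Filter.Eventually.of_forall hcond), integral_fintype_prod_eq_prod F]
  have hone : ∀ e : VertexPair n, ∫ t in Set.Icc (0 : ℝ) 1, F e t
      = if e ∈ D then p * H (x e.1.1) (x e.1.2) else 1 := by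
    intro e
    simp only [F]
    split_ifs
    · refine setIntegral_Icc_le_indicator ⟨mul_nonneg hp.1 (hH01 _ _).1, ?_⟩
      exact mul_le_one₀ hp.2 (hH01 _ _).1 (hH01 _ _).2
    · simp
  simp_rw [hone]
  simp [connectionProd, Finset.prod_ite_mem, Finset.prod_mul_distrib]

theorem integral_edgesPresent_nonneg (ν : Measure ((Fin n → V) × (VertexPair n → ℝ)))
    (D : Finset (VertexPair n)) : 0 ≤ ∫ z, edgesPresent H p D z ∂ν :=
  integral_nonneg fun z => (edgesPresent_mem_Icc D z).1

theorem integral_edgesPresent_le {μ : Measure V} [IsProbabilityMeasure μ]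
    (hHm : Measurable fun z : V × V => H z.1 z.2)
    (hH01 : ∀ x y, H x y ∈ Set.Icc (0 : ℝ) 1) (hp : p ∈ Set.Icc (0 : ℝ) 1)
    (D : Finset (VertexPair n)) :
    ∫ z, edgesPresent H p D z ∂connectionLaw μ n ≤ p ^ D.card := by
  rw [integral_edgesPresent hHm hH01 hp]
  refine mul_le_of_le_one_right (pow_nonneg hp.1 _) ?_
  have h := integral_mono_of_nonneg (μ := Measure.pi fun _ : Fin n => μ)
    (Filter.Eventually.of_forall fun x => (connectionProd_mem_Icc hH01 D x).1)
    (integrable_const (1 : ℝ))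
    (Filter.Eventually.of_forall fun x => (connectionProd_mem_Icc hH01 D x).2)
  simpa using h

theorem integral_connectionProd_union {μ : Measure V} [IsProbabilityMeasure μ]
    (hHm : Measurable fun z : V × V => H z.1 z.2) {S T : Finset (Fin n)} (hST : Disjoint S T)
    {D E : Finset (VertexPair n)} (hD : ∀ e ∈ D, e.1.1 ∈ S ∧ e.1.2 ∈ S)
    (hE : ∀ e ∈ E, e.1.1 ∈ T ∧ e.1.2 ∈ T) :
    ∫ x, connectionProd H (D ∪ E) x ∂(Measure.pi fun _ => μ)
      = (∫ x, connectionProd H D x ∂(Measure.pi fun _ => μ))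
        * ∫ x, connectionProd H E x ∂(Measure.pi fun _ => μ) := by
  obtain ⟨v⟩ : Nonempty V := μ.nonempty_of_neZero
  have hDE : Disjoint D E := Finset.disjoint_left.2 fun e heD heE =>
    Finset.disjoint_left.1 hST (hD e heD).1 (hE e heE).1
  let extend (S : Finset (Fin n)) (w : S → V) (i : Fin n) : V :=
    if h : i ∈ S then w ⟨i, h⟩ else v
  have hextend : ∀ S, Measurable (extend S) := fun S => measurable_pi_lambda _ fun i => by
    by_cases h : i ∈ S
    · simpa [extend, h] using measurable_pi_apply _
    · simp [extend, h]
  have hrestr : ∀ (S : Finset (Fin n)) (D : Finset (VertexPair n)),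
      (∀ e ∈ D, e.1.1 ∈ S ∧ e.1.2 ∈ S) → ∀ x : Fin n → V,
      connectionProd H D (extend S fun i => x i) = connectionProd H D x := fun S D hD x =>
    Finset.prod_congr rfl fun e he => by simp [extend, hD e he]
  have hind : iIndepFun (fun (i : Fin n) (x : Fin n → V) => x i) (Measure.pi fun _ => μ) :=
    iIndepFun_pi (X := fun _ => id) fun _ => aemeasurable_id
  have hcomp := (hind.indepFun_finset S T hST fun i => measurable_pi_apply i).comp
    ((measurable_connectionProd hHm D).comp (hextend S))
    ((measurable_connectionProd hHm E).comp (hextend T))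
  have hmul := hcomp.integral_fun_mul_eq_mul_integral
    (((measurable_connectionProd hHm D).comp (hextend S)).comp
      (measurable_pi_lambda _ fun i => measurable_pi_apply _)).aestronglyMeasurable
    (((measurable_connectionProd hHm E).comp (hextend T)).comp
      (measurable_pi_lambda _ fun i => measurable_pi_apply _)).aestronglyMeasurable
  simp only [Function.comp_apply, hrestr S D hD, hrestr T E hE] at hmul
  rw [← hmul]
  congr 1
  ext x
  exact Finset.prod_union hDE

theorem integral_edgesPresent_union {μ : Measure V} [IsProbabilityMeasure μ]
    (hHm : Measurable fun z : V × V => H z.1 z.2)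
    (hH01 : ∀ x y, H x y ∈ Set.Icc (0 : ℝ) 1) (hp : p ∈ Set.Icc (0 : ℝ) 1)
    {S T : Finset (Fin n)} (hST : Disjoint S T)
    {D E : Finset (VertexPair n)} (hD : ∀ e ∈ D, e.1.1 ∈ S ∧ e.1.2 ∈ S)
    (hE : ∀ e ∈ E, e.1.1 ∈ T ∧ e.1.2 ∈ T) :
    ∫ z, edgesPresent H p (D ∪ E) z ∂connectionLaw μ n
      = (∫ z, edgesPresent H p D z ∂connectionLaw μ n)
        * ∫ z, edgesPresent H p E z ∂connectionLaw μ n := by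
  have hDE : Disjoint D E := Finset.disjoint_left.2 fun e heD heE =>
    Finset.disjoint_left.1 hST (hD e heD).1 (hE e heE).1
  simp only [integral_edgesPresent hHm hH01 hp, integral_connectionProd_union hHm hST hD hE,
    Finset.card_union_of_disjoint hDE, pow_add]
  ring

end RandomConnection

theorem prod_integral_prod_sum {Ω α T : Type*} [MeasurableSpace Ω] (ν : Measure Ω)
    [Fintype α] [DecidableEq α] [Fintype T] (f : T → Ω → ℝ)
    (hf : ∀ (s : Finset α) (B : s → T), Integrable (fun z => ∏ i, f (B i) z) ν)
    (σ : Finpartition (Finset.univ : Finset α)) :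
    ∏ b ∈ σ.parts, ∫ z, ∏ _i ∈ b, ∑ t, f t z ∂ν
      = ∑ B : α → T, ∏ b ∈ σ.parts, ∫ z, ∏ i ∈ b, f (B i) z ∂ν := by
  classical
  have hblock : ∀ b : Finset α, ∫ z, ∏ _i ∈ b, ∑ t, f t z ∂ν
      = ∑ h : b → T, ∫ z, ∏ i, f (h i) z ∂ν := by
    intro b
    rw [← integral_finsetSum _ fun h _ => hf b h]
    congr 1
    ext z
    rw [← Finset.prod_coe_sort, Finset.prod_univ_sum, Fintype.piFinset_univ]
  let restr : (α → T) → (∀ b : σ.parts, b.1 → T) := fun B b i => B i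
  have hrestr : Function.Bijective restr := by
    constructor
    · intro B B' h
      funext x
      exact congrFun (congrFun h ⟨σ.part x, σ.part_mem.2 (Finset.mem_univ x)⟩)
        ⟨x, σ.mem_part (Finset.mem_univ x)⟩
    · intro h
      refine ⟨fun x => h ⟨σ.part x, σ.part_mem.2 (Finset.mem_univ x)⟩
        ⟨x, σ.mem_part (Finset.mem_univ x)⟩, ?_⟩
      funext ⟨b, hb⟩ ⟨i, hi⟩
      have := σ.part_eq_of_mem hb hi
      subst this
      rfl
  simp_rw [hblock]
  rw [← Finset.prod_coe_sort, Finset.prod_univ_sum, Fintype.piFinset_univ,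
    ← hrestr.sum_comp]
  refine Finset.sum_congr rfl fun B _ => ?_
  rw [← Finset.prod_coe_sort σ.parts fun b => ∫ z, ∏ i ∈ b, f (B i) z ∂ν]
  refine Finset.prod_congr rfl fun b _ => ?_
  congr 1
  ext z
  exact Finset.prod_coe_sort b.1 (fun i => f (B i) z)

theorem jointCumulant_sum {Ω T : Type*} [MeasurableSpace Ω] (ν : Measure Ω) [Fintype T]
    {j : ℕ} (c : ℝ) (f : T → Ω → ℝ)
    (hf : ∀ (s : Finset (Fin j)) (B : s → T), Integrable (fun z => ∏ i, f (B i) z) ν) :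
    cum ν j (fun z => c * ∑ t, f t z)
      = c ^ j * ∑ B : Fin j → T, jointCumulant ν (fun i => f (B i)) := by
  unfold cum jointCumulant
  rw [Finset.sum_comm, Finset.mul_sum]
  refine Finset.sum_congr rfl fun σ _ => ?_
  simp_rw [Finset.prod_mul_distrib, Finset.prod_const, integral_const_mul]
  rw [Finset.prod_mul_distrib, Finset.prod_pow_eq_pow_sum, σ.sum_card_parts, Finset.card_univ,
    Fintype.card_fin, ← Finset.mul_sum, ← prod_integral_prod_sum ν f hf]
  simp_rw [Finset.prod_const]
  ring

section Copies

variable {k n : ℕ} (G : SimpleGraph (Fin k)) [DecidableRel G.Adj]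

/-- The pairs of indices joined by the copy of `G` placed along `β`. -/
def copyEdges (β : Fin k ↪ Fin n) : Finset (VertexPair n) :=
  Finset.univ.filter fun e => ∃ u v, G.Adj u v ∧ β u = e.1.1 ∧ β v = e.1.2

/-- The partition of the grid identifying positions that carry the same index. -/
def gridPartition {j : ℕ} (B : Fin j → (Fin k ↪ Fin n)) :
    Finpartition (Finset.univ : Finset (Fin j × Fin k)) :=
  fibrePartition fun x : Fin j × Fin k => B x.1 x.2

theorem mem_part_gridPartition {j : ℕ} {B : Fin j → (Fin k ↪ Fin n)} {x y : Fin j × Fin k} :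
    y ∈ (gridPartition B).part x ↔ B x.1 x.2 = B y.1 y.2 :=
  mem_part_fibrePartition

theorem nonFlat_gridPartition {j : ℕ} (B : Fin j → (Fin k ↪ Fin n)) :
    NonFlat (gridPartition B) := by
  intro b hb x hx y hy hxy
  rw [← (gridPartition B).part_eq_of_mem hb hx, mem_part_gridPartition, hxy] at hy
  exact Prod.ext hxy ((B y.1).injective hy)

theorem contrEdges_gridPartition_le {j : ℕ} (B : Fin j → (Fin k ↪ Fin n)) :
    contrEdges G (gridPartition B)
      ≤ (Finset.univ.biUnion fun i => copyEdges G (B i)).card := by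
  unfold contrEdges
  set D := Finset.univ.biUnion fun i => copyEdges G (B i) with hD
  refine Nat.div_le_of_le_mul ?_
  let fib : Fin n → Finset (Fin j × Fin k) := fun a => Finset.univ.filter fun y => B y.1 y.2 = a
  let Q := D.image (fun e => e.1) ∪ D.image (fun e => e.1.swap)
  have hQ : Q.card ≤ 2 * D.card := by
    refine (Finset.card_union_le _ _).trans ?_
    rw [two_mul]
    exact add_le_add Finset.card_image_le Finset.card_image_le
  refine le_trans ?_ hQ
  refine (Finset.card_le_card ?_).trans
    (Finset.card_image_le (f := fun q : Fin n × Fin n => (fib q.1, fib q.2)))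
  rintro ⟨b₁, b₂⟩ hb
  simp only [Finset.mem_filter, Finset.mem_product] at hb
  obtain ⟨⟨hb₁, hb₂⟩, -, i, u, v, huv, hu, hv⟩ := hb
  have hfib : ∀ b ∈ (gridPartition B).parts, ∀ x ∈ b, fib (B x.1 x.2) = b := by
    intro b hb x hx
    rw [← (gridPartition B).part_eq_of_mem hb hx]
    exact (part_fibrePartition _ x).symm
  refine Finset.mem_image.2 ⟨(B i u, B i v), ?_, ?_⟩
  · have hne : B i u ≠ B i v := fun h => huv.ne ((B i).injective h)
    rcases lt_or_gt_of_ne hne with h | h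
    · refine Finset.mem_union_left _ (Finset.mem_image.2 ⟨⟨(B i u, B i v), h⟩, ?_, rfl⟩)
      simp only [hD, copyEdges, Finset.mem_biUnion, Finset.mem_filter, Finset.mem_univ, true_and]
      exact ⟨i, u, v, huv, rfl, rfl⟩
    · refine Finset.mem_union_right _ (Finset.mem_image.2 ⟨⟨(B i v, B i u), h⟩, ?_, rfl⟩)
      simp only [hD, copyEdges, Finset.mem_biUnion, Finset.mem_filter, Finset.mem_univ, true_and]
      exact ⟨i, v, u, huv.symm, rfl, rfl⟩
  · exact Prod.ext (hfib b₁ hb₁ _ hu) (hfib b₂ hb₂ _ hv)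

theorem card_biUnion_univ_le_sum_parts {ι γ : Type*} [Fintype ι] [DecidableEq ι] [DecidableEq γ]
    (σ : Finpartition (Finset.univ : Finset ι)) (D : ι → Finset γ) :
    (Finset.univ.biUnion D).card ≤ ∑ b ∈ σ.parts, (b.biUnion D).card := by
  refine (Finset.card_le_card ?_).trans Finset.card_biUnion_le
  intro e he
  obtain ⟨i, -, hi⟩ := Finset.mem_biUnion.1 he
  exact Finset.mem_biUnion.2 ⟨σ.part i, σ.part_mem.2 (Finset.mem_univ i),
    Finset.mem_biUnion.2 ⟨i, σ.mem_part (Finset.mem_univ i), hi⟩⟩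

variable {V : Type*} [MeasurableSpace V] {μ : Measure V} [IsProbabilityMeasure μ]
  {H : V → V → ℝ} {p : ℝ}

theorem jointCumulant_copies_eq {j : ℕ} (B : Fin j → (Fin k ↪ Fin n))
    (ν : Measure ((Fin n → V) × (VertexPair n → ℝ))) :
    jointCumulant ν (fun i => edgesPresent H p (copyEdges G (B i)))
      = ∑ σ : Finpartition (Finset.univ : Finset (Fin j)),
        (-1 : ℝ) ^ (σ.parts.card - 1) * ((σ.parts.card - 1).factorial : ℝ) *
          ∏ b ∈ σ.parts, ∫ z, edgesPresent H p (b.biUnion fun i => copyEdges G (B i)) z ∂ν := by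
  simp only [jointCumulant, prod_edgesPresent]

theorem jointCumulant_copies_eq_zero {j : ℕ} (hHm : Measurable fun z : V × V => H z.1 z.2)
    (hH01 : ∀ x y, H x y ∈ Set.Icc (0 : ℝ) 1) (hp : p ∈ Set.Icc (0 : ℝ) 1)
    (B : Fin j → (Fin k ↪ Fin n)) (hB : ¬ ConnP (gridPartition B)) :
    jointCumulant (connectionLaw μ n) (fun i => edgesPresent H p (copyEdges G (B i))) = 0 := by
  rw [jointCumulant_copies_eq]
  unfold ConnP at hB
  push Not at hB
  obtain ⟨A, hA, hAu, hsep⟩ := hB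
  obtain ⟨i₁, hi₁⟩ := hA
  obtain ⟨i₂, hi₂⟩ : ∃ i, i ∉ A := by
    by_contra! h
    exact hAu (Finset.eq_univ_iff_forall.2 h)
  refine cumulant_sum_eq_zero_of_split
    (fun b => ∫ z, edgesPresent H p (b.biUnion fun i => copyEdges G (B i)) z ∂connectionLaw μ n)
    (by simp [edgesPresent]) (· ∈ A) ⟨i₁, hi₁⟩ ⟨i₂, hi₂⟩ fun b => ?_
  have hunion : b.biUnion (fun i => copyEdges G (B i))
      = (b.filter (· ∈ A)).biUnion (fun i => copyEdges G (B i))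
        ∪ (b.filter fun i => i ∉ A).biUnion (fun i => copyEdges G (B i)) := by
    rw [← Finset.union_biUnion, Finset.filter_union_filter_not_eq]
  let vert : Finset (Fin j) → Finset (Fin n) := fun s => s.biUnion fun i => Finset.univ.map (B i)
  have hvert : ∀ s : Finset (Fin j), ∀ e ∈ s.biUnion (fun i => copyEdges G (B i)),
      e.1.1 ∈ vert s ∧ e.1.2 ∈ vert s := by
    intro s e he
    obtain ⟨i, hi, hie⟩ := Finset.mem_biUnion.1 he
    obtain ⟨u, v, -, hu, hv⟩ := (Finset.mem_filter.1 hie).2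
    exact ⟨Finset.mem_biUnion.2 ⟨i, hi, by simp [← hu]⟩,
      Finset.mem_biUnion.2 ⟨i, hi, by simp [← hv]⟩⟩
  have hdisj : Disjoint (vert (b.filter (· ∈ A))) (vert (b.filter fun i => i ∉ A)) := by
    rw [Finset.disjoint_left]
    intro a ha ha'
    obtain ⟨i, hi, hia⟩ := Finset.mem_biUnion.1 ha
    obtain ⟨i', hi', hia'⟩ := Finset.mem_biUnion.1 ha'
    obtain ⟨u, -, rfl⟩ := Finset.mem_map.1 hia
    obtain ⟨v, -, huv⟩ := Finset.mem_map.1 hia'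
    have hpart := (gridPartition B).part_mem.2 (Finset.mem_univ (i, u))
    exact (Finset.mem_filter.1 hi').2 (hsep _ hpart
      ⟨(i, u), mem_part_gridPartition.2 rfl, (Finset.mem_filter.1 hi).2⟩ (i', v)
      (mem_part_gridPartition.2 huv.symm))
  rw [hunion]
  exact integral_edgesPresent_union hHm hH01 hp hdisj (hvert _) (hvert _)

theorem abs_jointCumulant_copies_le {j : ℕ} (hj : 0 < j)
    (hHm : Measurable fun z : V × V => H z.1 z.2)
    (hH01 : ∀ x y, H x y ∈ Set.Icc (0 : ℝ) 1) (hp : p ∈ Set.Icc (0 : ℝ) 1)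
    (B : Fin j → (Fin k ↪ Fin n)) :
    |jointCumulant (connectionLaw μ n) (fun i => edgesPresent H p (copyEdges G (B i)))|
      ≤ (j : ℝ) ^ (j - 1) * p ^ contrEdges G (gridPartition B) := by
  rw [jointCumulant_copies_eq]
  have hprod : ∀ σ : Finpartition (Finset.univ : Finset (Fin j)),
      ∏ b ∈ σ.parts, ∫ z, edgesPresent H p (b.biUnion fun i => copyEdges G (B i)) z
          ∂connectionLaw μ n
        ≤ p ^ contrEdges G (gridPartition B) := fun σ => by
    refine (Finset.prod_le_prod (fun b _ => integral_edgesPresent_nonneg _ _)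
      fun b _ => integral_edgesPresent_le hHm hH01 hp _).trans ?_
    rw [Finset.prod_pow_eq_pow_sum]
    exact pow_le_pow_of_le_one hp.1 hp.2
      ((contrEdges_gridPartition_le G B).trans (card_biUnion_univ_le_sum_parts σ _))
  refine (Finset.abs_sum_le_sum_abs _ _).trans ?_
  calc _ ≤ ∑ σ : Finpartition (Finset.univ : Finset (Fin j)),
        ((σ.parts.card - 1).factorial : ℝ) * p ^ contrEdges G (gridPartition B) := by
        refine Finset.sum_le_sum fun σ _ => ?_
        rw [abs_mul, abs_mul, abs_pow, abs_neg, abs_one, one_pow, one_mul, Nat.abs_cast,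
          abs_of_nonneg (Finset.prod_nonneg fun b _ => integral_edgesPresent_nonneg _ _)]
        exact mul_le_mul_of_nonneg_left (hprod σ) (Nat.cast_nonneg _)
    _ ≤ _ := by
        rw [← Finset.sum_mul]
        refine mul_le_mul_of_nonneg_right ?_ (pow_nonneg hp.1 _)
        exact_mod_cast sum_factorial_card_parts_le j hj

end Copies

section BlockCount

variable {j k : ℕ} {ρ : Finpartition (Finset.univ : Finset (Fin j × Fin k))}

theorem le_card_parts_of_nonFlat (hj : 0 < j) (hρ : NonFlat ρ) : k ≤ ρ.parts.card := by
  have h := Finset.card_le_card_of_injOn (s := (Finset.univ : Finset (Fin k))) (t := ρ.parts)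
    (fun u => ρ.part (⟨0, hj⟩, u)) (fun u _ => ρ.part_mem.2 (Finset.mem_univ _)) ?_
  · simpa using h
  · intro u _ v _ huv
    have hv := ρ.mem_part (Finset.mem_univ (⟨0, hj⟩, v))
    have huv' : ρ.part (⟨0, hj⟩, u) = ρ.part (⟨0, hj⟩, v) := huv
    rw [← huv'] at hv
    have h := hρ _ (ρ.part_mem.2 (Finset.mem_univ _)) (⟨0, hj⟩, u)
      (ρ.mem_part (Finset.mem_univ _)) (⟨0, hj⟩, v) hv rfl
    exact congrArg Prod.snd h

theorem exists_rows_card_parts_le (hk : 0 < k) (hρ : ConnP ρ) (m : ℕ) (hm : m + 1 ≤ j) :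
    ∃ A : Finset (Fin j), A.card = m + 1 ∧
      ((A ×ˢ (Finset.univ : Finset (Fin k))).image ρ.part).card ≤ 1 + (k - 1) * (m + 1) := by
  induction m with
  | zero =>
    refine ⟨{⟨0, hm⟩}, by simp, Finset.card_image_le.trans ?_⟩
    simp
    omega
  | succ m ih =>
    obtain ⟨A, hA, hle⟩ := ih (by omega)
    obtain ⟨b, hb, ⟨x, hxb, hxA⟩, ⟨i, u⟩, hyb, hiA⟩ := hρ A (Finset.card_pos.1 (by omega))
      (fun h => by
        rw [h, Finset.card_univ, Fintype.card_fin] at hA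
        omega)
    refine ⟨insert i A, by rw [Finset.card_insert_of_notMem hiA, hA], ?_⟩
    have hsub : (insert i A ×ˢ (Finset.univ : Finset (Fin k))).image ρ.part
        ⊆ (A ×ˢ (Finset.univ : Finset (Fin k))).image ρ.part
          ∪ (Finset.univ.erase u).image (fun v => ρ.part (i, v)) := by
      intro c hc
      obtain ⟨⟨i', v⟩, hiv, rfl⟩ := Finset.mem_image.1 hc
      simp only [Finset.mem_product, Finset.mem_insert, Finset.mem_univ, and_true] at hiv
      rcases hiv with rfl | h
      · by_cases hvu : v = u
        · subst hvu
          refine Finset.mem_union_left _ (Finset.mem_image.2 ⟨x, by simp [hxA], ?_⟩)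
          rw [ρ.part_eq_of_mem hb hxb, ρ.part_eq_of_mem hb hyb]
        · exact Finset.mem_union_right _ (Finset.mem_image.2 ⟨v, by simp [hvu], rfl⟩)
      · exact Finset.mem_union_left _ (Finset.mem_image.2 ⟨(i', v), by simp [h], rfl⟩)
    have h1 : ((Finset.univ.erase u).image (fun v => ρ.part (i, v))).card ≤ k - 1 :=
      Finset.card_image_le.trans (by simp)
    have h2 := (Finset.card_le_card hsub).trans (Finset.card_union_le _ _)
    have h3 : (k - 1) * (m + 1 + 1) = (k - 1) * (m + 1) + (k - 1) := by ring
    omega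

theorem card_parts_le_of_connP (hk : 0 < k) (hj : 0 < j) (hρ : ConnP ρ) :
    ρ.parts.card ≤ 1 + (k - 1) * j := by
  obtain ⟨i, rfl⟩ := Nat.exists_eq_add_of_lt hj
  obtain ⟨A, hA, hle⟩ := exists_rows_card_parts_le hk hρ i (by omega)
  have hAu : A = Finset.univ := (Finset.card_eq_iff_eq_univ A).1 (by simp [hA])
  rw [finpartition_parts_eq_image_part]
  simpa [hAu] using hle

end BlockCount

theorem card_filter_gridPartition_eq_le {j k n : ℕ}
    (ρ : Finpartition (Finset.univ : Finset (Fin j × Fin k))) :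
    (Finset.univ.filter (fun B : Fin j → (Fin k ↪ Fin n) => gridPartition B = ρ)).card
      ≤ n ^ ρ.parts.card := by
  calc _ ≤ (Finset.univ.filter
        (fun g : Fin j × Fin k → Fin n => fibrePartition g = ρ)).card := by
        refine Finset.card_le_card_of_injOn (fun B x => B x.1 x.2) (fun B hB => ?_) ?_
        · exact Finset.mem_filter.2 ⟨Finset.mem_univ _, (Finset.mem_filter.1 hB).2⟩
        · intro B _ B' _ h
          ext i u
          exact congrArg Fin.val (congrFun h (i, u))
    _ = n.descFactorial ρ.parts.card := by rw [card_filter_fibrePartition_eq, Fintype.card_fin]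
    _ ≤ _ := Nat.descFactorial_le_pow n _

theorem sum_abs_jointCumulant_copies_le {V : Type*} [MeasurableSpace V] {μ : Measure V}
    [IsProbabilityMeasure μ] {H : V → V → ℝ} {p : ℝ} {j k n : ℕ} (hk : 0 < k) (hj : 0 < j)
    (G : SimpleGraph (Fin k)) [DecidableRel G.Adj]
    (hHm : Measurable fun z : V × V => H z.1 z.2)
    (hH01 : ∀ x y, H x y ∈ Set.Icc (0 : ℝ) 1) (hp : p ∈ Set.Icc (0 : ℝ) 1) :
    ∑ B : Fin j → (Fin k ↪ Fin n),
      |jointCumulant (connectionLaw μ n) (fun i => edgesPresent H p (copyEdges G (B i)))|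
      ≤ (j : ℝ) ^ (j - 1) * ∑ r ∈ Finset.Icc k (1 + (k - 1) * j),
        (cnfCard j k r : ℝ) * (n : ℝ) ^ r * p ^ dMin G j r := by
  classical
  let C := (Finset.univ : Finset (Finpartition (Finset.univ : Finset (Fin j × Fin k)))).filter
    fun ρ => NonFlat ρ ∧ ConnP ρ
  have hblock : ∀ ρ ∈ C, ∑ B ∈ Finset.univ.filter
      (fun B : Fin j → (Fin k ↪ Fin n) => gridPartition B = ρ),
      |jointCumulant (connectionLaw μ n) (fun i => edgesPresent H p (copyEdges G (B i)))|
      ≤ (j : ℝ) ^ (j - 1) * ((n : ℝ) ^ ρ.parts.card * p ^ dMin G j ρ.parts.card) := by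
    intro ρ hρ
    obtain ⟨hnf, hc⟩ := (Finset.mem_filter.1 hρ).2
    refine (Finset.sum_le_card_nsmul _ _ ((j : ℝ) ^ (j - 1) * p ^ dMin G j ρ.parts.card)
      fun B hB => ?_).trans ?_
    · refine (abs_jointCumulant_copies_le G hj hHm hH01 hp B).trans ?_
      rw [(Finset.mem_filter.1 hB).2]
      refine mul_le_mul_of_nonneg_left (pow_le_pow_of_le_one hp.1 hp.2 ?_) (by positivity)
      exact Nat.sInf_le ⟨ρ, hnf, hc, rfl, rfl⟩
    · rw [nsmul_eq_mul, mul_left_comm]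
      refine mul_le_mul_of_nonneg_left ?_ (by positivity)
      refine mul_le_mul_of_nonneg_right ?_ (pow_nonneg hp.1 _)
      exact_mod_cast card_filter_gridPartition_eq_le ρ
  calc _ = ∑ B ∈ Finset.univ.filter
          (fun B : Fin j → (Fin k ↪ Fin n) => gridPartition B ∈ C),
        |jointCumulant (connectionLaw μ n) (fun i => edgesPresent H p (copyEdges G (B i)))| := by
        symm
        refine Finset.sum_subset (Finset.filter_subset _ _) fun B _ hB => ?_
        rw [jointCumulant_copies_eq_zero G hHm hH01 hp B, abs_zero]
        simpa [C, nonFlat_gridPartition] using hB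
    _ = ∑ ρ ∈ C, ∑ B ∈ Finset.univ.filter
          (fun B : Fin j → (Fin k ↪ Fin n) => gridPartition B = ρ),
        |jointCumulant (connectionLaw μ n)
          (fun i => edgesPresent H p (copyEdges G (B i)))| := by
        rw [← Finset.sum_fiberwise_of_maps_to (t := C) (g := gridPartition)
          fun B hB => (Finset.mem_filter.1 hB).2]
        refine Finset.sum_congr rfl fun ρ hρ => Finset.sum_congr ?_ fun _ _ => rfl
        ext B
        simp only [Finset.mem_filter, Finset.mem_univ, true_and]
        exact ⟨fun h => h.2, fun h => ⟨h ▸ hρ, h⟩⟩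
    _ ≤ ∑ ρ ∈ C, (j : ℝ) ^ (j - 1) * ((n : ℝ) ^ ρ.parts.card * p ^ dMin G j ρ.parts.card) :=
        Finset.sum_le_sum hblock
    _ = _ := by
        rw [← Finset.mul_sum, ← Finset.sum_fiberwise_of_maps_to
          (t := Finset.Icc k (1 + (k - 1) * j)) (g := fun ρ => ρ.parts.card)]
        · congr 1
          refine Finset.sum_congr rfl fun r _ => ?_
          have hcard : cnfCard j k r = (C.filter fun ρ => ρ.parts.card = r).card := by
            rw [cnfCard, Nat.card_eq_fintype_card, Fintype.card_subtype]
            simp only [C, Finset.filter_filter, and_assoc]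
          rw [hcard, mul_assoc, ← nsmul_eq_mul]
          refine Finset.sum_eq_card_nsmul fun ρ hρ => ?_
          rw [(Finset.mem_filter.1 hρ).2]
        · intro ρ hρ
          obtain ⟨hnf, hc⟩ := (Finset.mem_filter.1 hρ).2
          exact Finset.mem_Icc.2 ⟨le_card_parts_of_nonFlat hj hnf,
            card_parts_le_of_connP hk hj hc⟩

theorem NG_eq_sum_edgesPresent {d k n : ℕ} {Ω : Type*} (G : SimpleGraph (Fin k))
    [DecidableRel G.Adj] {H : (Fin d → ℝ) → (Fin d → ℝ) → ℝ} (hHsym : ∀ x y, H x y = H y x)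
    (p : ℝ) (a : ℕ) (X : Fin n → Ω → (Fin d → ℝ)) {Y : Fin n → Fin n → Ω → ℝ}
    (hYsym : ∀ a b, Y a b = Y b a) (ω : Ω) :
    NG G H p a X Y ω = (a : ℝ)⁻¹ * ∑ β : Fin k ↪ Fin n, edgesPresent H p (copyEdges G β)
      ((fun i => X i ω), fun q : VertexPair n => Y q.1.1 q.1.2 ω) := by
  unfold NG
  congr 1
  symm
  refine Finset.sum_bij (fun β _ => β) (fun β _ => by simp [β.injective])
    (fun β _ β' _ h => DFunLike.coe_injective h)
    (fun β hβ => ⟨⟨β, (Finset.mem_filter.1 hβ).2⟩, Finset.mem_univ _, rfl⟩) fun β _ => ?_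
  rw [edgesPresent_eq_ite, Finset.prod_boole]
  congr 1
  apply propext
  simp only [copyEdges, Finset.mem_filter, Finset.mem_univ, true_and]
  constructor
  · rintro h q ⟨-, hadj⟩
    rcases lt_or_gt_of_ne (fun hq => hadj.ne (β.injective hq) : β q.1 ≠ β q.2) with hlt | hlt
    · exact h ⟨(β q.1, β q.2), hlt⟩ ⟨q.1, q.2, hadj, rfl, rfl⟩
    · rw [hYsym, hHsym]
      exact h ⟨(β q.2, β q.1), hlt⟩ ⟨q.2, q.1, hadj.symm, rfl, rfl⟩
  · rintro h e ⟨u, v, hadj, hu, hv⟩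
    rw [← hu, ← hv]
    rcases lt_or_gt_of_ne hadj.ne with hlt | hlt
    · exact h (u, v) ⟨hlt, hadj⟩
    · rw [hYsym, hHsym]
      exact h (v, u) ⟨hlt, hadj.symm⟩

theorem cum_comp_of_map_eq {Ω Ω' : Type*} [MeasurableSpace Ω] [MeasurableSpace Ω']
    {P : Measure Ω} {ν : Measure Ω'} [NeZero ν] {Φ : Ω → Ω'} (hΦ : Measure.map Φ P = ν)
    {W : Ω' → ℝ} (hW : Measurable W) (j : ℕ) :
    cum P j (fun ω => W (Φ ω)) = cum ν j W := by
  have hΦm : AEMeasurable Φ P := AEMeasurable.of_map_ne_zero (hΦ ▸ NeZero.ne ν)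
  unfold cum jointCumulant
  refine Finset.sum_congr rfl fun σ _ => ?_
  congr 1
  refine Finset.prod_congr rfl fun b _ => ?_
  rw [← hΦ, integral_map hΦm (Finset.measurable_fun_prod b fun _ _ => hW).aestronglyMeasurable]

/-- Cumulant upper bound for subgraph counts in the binomial random-connection model:
for `j ≥ 2`,
`|κ_j(N_G)| ≤ (j^{j−1}/a(G)^j) Σ_{r=k}^{1+(k−1)j} |C(j,k,r)| n^r p_n^{d(j,k,r)}`. -/
theorem cumulant_bound_subgraph_count {d k : ℕ} (hk : 2 ≤ k)
    (G : SimpleGraph (Fin k)) [DecidableRel G.Adj] (hGconn : G.Connected)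
    {n : ℕ} {Ω : Type*} [MeasurableSpace Ω] (P : Measure Ω) [IsProbabilityMeasure P]
    (μ : Measure (Fin d → ℝ)) [IsProbabilityMeasure μ] (hμ : ∀ x, μ {x} = 0)
    (H : (Fin d → ℝ) → (Fin d → ℝ) → ℝ)
    (hHm : Measurable fun z : (Fin d → ℝ) × (Fin d → ℝ) => H z.1 z.2)
    (hHsym : ∀ x y, H x y = H y x) (hH01 : ∀ x y, H x y ∈ Set.Icc (0 : ℝ) 1)
    (pn : ℝ) (hpn : pn ∈ Set.Ioo (0 : ℝ) 1)
    (X : Fin n → Ω → (Fin d → ℝ)) (Y : Fin n → Fin n → Ω → ℝ)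
    (hYsym : ∀ a b, Y a b = Y b a)
    (hlaw : Measure.map (fun ω => ((fun i => X i ω),
        (fun q : {q : Fin n × Fin n // q.1 < q.2} => Y q.1.1 q.1.2 ω))) P
      = (Measure.pi fun _ => μ).prod
          (Measure.pi fun _ => (volume.restrict (Set.Icc (0 : ℝ) 1)))) :
    ∀ j, 2 ≤ j →
      |cum P j (NG G H pn (autCard G) X Y)|
        ≤ (j : ℝ) ^ (j - 1) / (autCard G : ℝ) ^ j *
            ∑ r ∈ Finset.Icc k (1 + (k - 1) * j),
              (cnfCard j k r : ℝ) * (n : ℝ) ^ r * pn ^ dMin G j r := by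
  intro j hj
  have hp : pn ∈ Set.Icc (0 : ℝ) 1 := ⟨hpn.1.le, hpn.2.le⟩
  have hint : ∀ (s : Finset (Fin j)) (B : s → (Fin k ↪ Fin n)), Integrable
      (fun z => ∏ i, edgesPresent H pn (copyEdges G (B i)) z) (connectionLaw μ n) := fun s B => by
    simp_rw [prod_edgesPresent]
    exact integrable_edgesPresent hHm _ _
  have hmeas : Measurable fun z => (autCard G : ℝ)⁻¹ *
      ∑ β : Fin k ↪ Fin n, edgesPresent H pn (copyEdges G β) z :=
    (Finset.measurable_fun_sum _ fun β _ => measurable_edgesPresent hHm _).const_mul _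
  have hcum : cum P j (NG G H pn (autCard G) X Y)
      = (autCard G : ℝ)⁻¹ ^ j * ∑ B : Fin j → (Fin k ↪ Fin n),
        jointCumulant (connectionLaw μ n)
          (fun i => edgesPresent H pn (copyEdges G (B i))) := by
    rw [← jointCumulant_sum (connectionLaw μ n) (autCard G : ℝ)⁻¹
      (fun β : Fin k ↪ Fin n => edgesPresent H pn (copyEdges G β)) hint,
      ← cum_comp_of_map_eq (ν := connectionLaw μ n) hlaw hmeas]
    congr 1
    funext ω
    exact NG_eq_sum_edgesPresent G hHsym pn (autCard G) X hYsym ω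
  rw [hcum, abs_mul, abs_of_nonneg (by positivity), div_eq_inv_mul, ← inv_pow, mul_assoc]
  refine mul_le_mul_of_nonneg_left ?_ (by positivity)
  exact (Finset.abs_sum_le_sum_abs _ _).trans
    (sum_abs_jointCumulant_copies_le (by omega) (by omega) G hHm hH01 hp)
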